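/- arXiv:1604.06286 — 2 statements merged into one kernel-verified Lean document; each statement's English description precedes it below -/
import Mathlib

section
/- Let n ≥ 4 and let α and β be any two positive roots of type D_n, written in simple-root coordinates. Then the support {i : α_i − β_i ≠ 0} of their difference α − β has at most three connected components in the Dynkin diagram of type D_n. -/
/-- The positive roots of type `Dₙ` in simple-root coordinates (nodes `0`-indexed; the
two fork nodes are `n-2` and `n-1`, both attached to the branching node `n-3`):
(i) `1` on an interval `[a, b]` with `b ≤ n-2`;
(ii) `1` on `[a, n-3]` and at `n-1`, `0` at `n-2` (including the lone simple root `e_{n-1}`);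
(iii) `1` on `[a, n-1]` with `a ≤ n-3`;
(iv) `1` on `[a, b-1]`, `2` on `[b, n-3]`, `1` at `n-2` and `n-1` (with `a < b ≤ n-3`). -/
def IsPosRootD (n : ℕ) (v : Fin n → ℤ) : Prop :=
  (∃ a b : ℕ, a ≤ b ∧ b ≤ n - 2 ∧
    v = fun i => if a ≤ i.val ∧ i.val ≤ b then 1 else 0) ∨
  (∃ a : ℕ, a ≤ n - 2 ∧
    v = fun i => if (a ≤ i.val ∧ i.val ≤ n - 3) ∨ i.val = n - 1 then 1 else 0) ∨
  (∃ a : ℕ, a ≤ n - 3 ∧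
    v = fun i => if a ≤ i.val then 1 else 0) ∨
  (∃ a b : ℕ, a < b ∧ b ≤ n - 3 ∧
    v = fun i => if n - 2 ≤ i.val then 1
      else if b ≤ i.val then 2 else if a ≤ i.val then 1 else 0)

/-- The Dynkin diagram of type `Dₙ` as a graph on `Fin n`: edges `{i, i+1}` for
`i + 1 ≤ n - 2`, together with the edge `{n-3, n-1}`. -/
def dynkinGraphD (n : ℕ) : SimpleGraph (Fin n) :=
  SimpleGraph.fromRel fun i j =>
    (i.val + 1 = j.val ∧ j.val ≤ n - 2) ∨ (i.val = n - 3 ∧ j.val = n - 1)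

/-- Extension of `IsPosRootD` to functions on `ℕ`. -/
def RootFn (n : ℕ) (g : ℕ → ℤ) : Prop :=
  (∃ a b : ℕ, a ≤ b ∧ b ≤ n - 2 ∧
    ∀ i, g i = if a ≤ i ∧ i ≤ b then 1 else 0) ∨
  (∃ a : ℕ, a ≤ n - 2 ∧
    ∀ i, g i = if (a ≤ i ∧ i ≤ n - 3) ∨ i = n - 1 then 1 else 0) ∨
  (∃ a : ℕ, a ≤ n - 3 ∧
    ∀ i, g i = if a ≤ i then 1 else 0) ∨
  (∃ a b : ℕ, a < b ∧ b ≤ n - 3 ∧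
    ∀ i, g i = if n - 2 ≤ i then 1
      else if b ≤ i then 2 else if a ≤ i then 1 else 0)

theorem exists_rootFn (n : ℕ) (v : Fin n → ℤ) (h : IsPosRootD n v) :
    ∃ g, RootFn n g ∧ ∀ i : Fin n, v i = g i.val := by
  rcases h with ⟨a, b, h1, h2, rfl⟩ | ⟨a, h1, rfl⟩ | ⟨a, h1, rfl⟩ | ⟨a, b, h1, h2, rfl⟩
  · exact ⟨_, Or.inl ⟨a, b, h1, h2, fun i => rfl⟩, fun i => rfl⟩
  · exact ⟨_, Or.inr (Or.inl ⟨a, h1, fun i => rfl⟩), fun i => rfl⟩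
  · exact ⟨_, Or.inr (Or.inr (Or.inl ⟨a, h1, fun i => rfl⟩)), fun i => rfl⟩
  · exact ⟨_, Or.inr (Or.inr (Or.inr ⟨a, b, h1, h2, fun i => rfl⟩)), fun i => rfl⟩

/-- All heads (vertices of the support whose predecessor is not in it) are in `{p,q,r}`. -/
def Heads (n : ℕ) (f g : ℕ → ℤ) (p q r : ℕ) : Prop :=
  ∀ i, i < n → f i ≠ g i → (i = p ∨ i = q ∨ i = r) ∨
    (i = n - 1 ∧ f (n - 3) ≠ g (n - 3)) ∨ (0 < i ∧ i ≤ n - 2 ∧ f (i - 1) ≠ g (i - 1))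

theorem Heads.symm {n : ℕ} {f g : ℕ → ℤ} {p q r : ℕ} (h : Heads n f g p q r) :
    Heads n g f p q r := by
  intro i hi hne
  rcases h i hi hne.symm with h | h | h
  · exact Or.inl h
  · exact Or.inr (Or.inl ⟨h.1, h.2.symm⟩)
  · exact Or.inr (Or.inr ⟨h.1, h.2.1, h.2.2.symm⟩)

theorem heads_11 (n : ℕ) (hn : 4 ≤ n) (f g : ℕ → ℤ) (a b : ℕ) (h1 : a ≤ b) (h2 : b ≤ n - 2)
    (hf : ∀ i, f i = if a ≤ i ∧ i ≤ b then 1 else 0)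
    (c d : ℕ) (k1 : c ≤ d) (k2 : d ≤ n - 2)
    (hg : ∀ i, g i = if c ≤ i ∧ i ≤ d then 1 else 0) :
    ∃ p q r, Heads n f g p q r := by
  refine ⟨(min a c), (if b < c ∨ d < a then max a c else min b d + 1), (n - 1), ?_⟩
  intro i hi hne
  have e1 := hf i
  have e2 := hg i
  have e3 := hf (i - 1)
  have e4 := hg (i - 1)
  have e5 := hf (n - 3)
  have e6 := hg (n - 3)
  clear hf hg
  grind (splits := 40)

theorem heads_12 (n : ℕ) (hn : 4 ≤ n) (f g : ℕ → ℤ) (a b : ℕ) (h1 : a ≤ b) (h2 : b ≤ n - 2)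
    (hf : ∀ i, f i = if a ≤ i ∧ i ≤ b then 1 else 0)
    (c : ℕ) (k1 : c ≤ n - 2)
    (hg : ∀ i, g i = if (c ≤ i ∧ i ≤ n - 3) ∨ i = n - 1 then 1 else 0) :
    ∃ p q r, Heads n f g p q r := by
  refine ⟨(min a c), (if b = n - 2 then n - 2 else if b < c then c else b + 1), (n - 1), ?_⟩
  intro i hi hne
  have e1 := hf i
  have e2 := hg i
  have e3 := hf (i - 1)
  have e4 := hg (i - 1)
  have e5 := hf (n - 3)
  have e6 := hg (n - 3)
  clear hf hg
  grind (splits := 40)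

theorem heads_13 (n : ℕ) (hn : 4 ≤ n) (f g : ℕ → ℤ) (a b : ℕ) (h1 : a ≤ b) (h2 : b ≤ n - 2)
    (hf : ∀ i, f i = if a ≤ i ∧ i ≤ b then 1 else 0)
    (c : ℕ) (k1 : c ≤ n - 3)
    (hg : ∀ i, g i = if c ≤ i then 1 else 0) :
    ∃ p q r, Heads n f g p q r := by
  refine ⟨(min a c), (if b < c then c else b + 1), (n - 1), ?_⟩
  intro i hi hne
  have e1 := hf i
  have e2 := hg i
  have e3 := hf (i - 1)
  have e4 := hg (i - 1)
  have e5 := hf (n - 3)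
  have e6 := hg (n - 3)
  clear hf hg
  grind (splits := 40)

theorem heads_14 (n : ℕ) (hn : 4 ≤ n) (f g : ℕ → ℤ) (a b : ℕ) (h1 : a ≤ b) (h2 : b ≤ n - 2)
    (hf : ∀ i, f i = if a ≤ i ∧ i ≤ b then 1 else 0)
    (c d : ℕ) (k1 : c < d) (k2 : d ≤ n - 3)
    (hg : ∀ i, g i = if n - 2 ≤ i then 1 else if d ≤ i then 2 else if c ≤ i then 1 else 0) :
    ∃ p q r, Heads n f g p q r := by
  refine ⟨(min a c), (if b < c then c else if b < d then b + 1 else d), (n - 1), ?_⟩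
  intro i hi hne
  have e1 := hf i
  have e2 := hg i
  have e3 := hf (i - 1)
  have e4 := hg (i - 1)
  have e5 := hf (n - 3)
  have e6 := hg (n - 3)
  clear hf hg
  grind (splits := 40)

theorem heads_22 (n : ℕ) (hn : 4 ≤ n) (f g : ℕ → ℤ) (a : ℕ) (h1 : a ≤ n - 2)
    (hf : ∀ i, f i = if (a ≤ i ∧ i ≤ n - 3) ∨ i = n - 1 then 1 else 0)
    (c : ℕ) (k1 : c ≤ n - 2)
    (hg : ∀ i, g i = if (c ≤ i ∧ i ≤ n - 3) ∨ i = n - 1 then 1 else 0) :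
    ∃ p q r, Heads n f g p q r := by
  refine ⟨(min a c), (n - 2), (n - 1), ?_⟩
  intro i hi hne
  have e1 := hf i
  have e2 := hg i
  have e3 := hf (i - 1)
  have e4 := hg (i - 1)
  have e5 := hf (n - 3)
  have e6 := hg (n - 3)
  clear hf hg
  grind (splits := 40)

theorem heads_23 (n : ℕ) (hn : 4 ≤ n) (f g : ℕ → ℤ) (a : ℕ) (h1 : a ≤ n - 2)
    (hf : ∀ i, f i = if (a ≤ i ∧ i ≤ n - 3) ∨ i = n - 1 then 1 else 0)
    (c : ℕ) (k1 : c ≤ n - 3)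
    (hg : ∀ i, g i = if c ≤ i then 1 else 0) :
    ∃ p q r, Heads n f g p q r := by
  refine ⟨(min a c), (n - 2), (n - 1), ?_⟩
  intro i hi hne
  have e1 := hf i
  have e2 := hg i
  have e3 := hf (i - 1)
  have e4 := hg (i - 1)
  have e5 := hf (n - 3)
  have e6 := hg (n - 3)
  clear hf hg
  grind (splits := 40)

theorem heads_24 (n : ℕ) (hn : 4 ≤ n) (f g : ℕ → ℤ) (a : ℕ) (h1 : a ≤ n - 2)
    (hf : ∀ i, f i = if (a ≤ i ∧ i ≤ n - 3) ∨ i = n - 1 then 1 else 0)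
    (c d : ℕ) (k1 : c < d) (k2 : d ≤ n - 3)
    (hg : ∀ i, g i = if n - 2 ≤ i then 1 else if d ≤ i then 2 else if c ≤ i then 1 else 0) :
    ∃ p q r, Heads n f g p q r := by
  refine ⟨(min a c), d, (n - 2), ?_⟩
  intro i hi hne
  have e1 := hf i
  have e2 := hg i
  have e3 := hf (i - 1)
  have e4 := hg (i - 1)
  have e5 := hf (n - 3)
  have e6 := hg (n - 3)
  clear hf hg
  grind (splits := 40)

theorem heads_33 (n : ℕ) (hn : 4 ≤ n) (f g : ℕ → ℤ) (a : ℕ) (h1 : a ≤ n - 3)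
    (hf : ∀ i, f i = if a ≤ i then 1 else 0)
    (c : ℕ) (k1 : c ≤ n - 3)
    (hg : ∀ i, g i = if c ≤ i then 1 else 0) :
    ∃ p q r, Heads n f g p q r := by
  refine ⟨(min a c), (n - 2), (n - 1), ?_⟩
  intro i hi hne
  have e1 := hf i
  have e2 := hg i
  have e3 := hf (i - 1)
  have e4 := hg (i - 1)
  have e5 := hf (n - 3)
  have e6 := hg (n - 3)
  clear hf hg
  grind (splits := 40)

theorem heads_34 (n : ℕ) (hn : 4 ≤ n) (f g : ℕ → ℤ) (a : ℕ) (h1 : a ≤ n - 3)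
    (hf : ∀ i, f i = if a ≤ i then 1 else 0)
    (c d : ℕ) (k1 : c < d) (k2 : d ≤ n - 3)
    (hg : ∀ i, g i = if n - 2 ≤ i then 1 else if d ≤ i then 2 else if c ≤ i then 1 else 0) :
    ∃ p q r, Heads n f g p q r := by
  refine ⟨(min a c), d, (n - 1), ?_⟩
  intro i hi hne
  have e1 := hf i
  have e2 := hg i
  have e3 := hf (i - 1)
  have e4 := hg (i - 1)
  have e5 := hf (n - 3)
  have e6 := hg (n - 3)
  clear hf hg
  grind (splits := 40)

theorem heads_44 (n : ℕ) (hn : 4 ≤ n) (f g : ℕ → ℤ) (a b : ℕ) (h1 : a < b) (h2 : b ≤ n - 3)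
    (hf : ∀ i, f i = if n - 2 ≤ i then 1 else if b ≤ i then 2 else if a ≤ i then 1 else 0)
    (c d : ℕ) (k1 : c < d) (k2 : d ≤ n - 3)
    (hg : ∀ i, g i = if n - 2 ≤ i then 1 else if d ≤ i then 2 else if c ≤ i then 1 else 0) :
    ∃ p q r, Heads n f g p q r := by
  refine ⟨(min a c), (min b d), (n - 1), ?_⟩
  intro i hi hne
  have e1 := hf i
  have e2 := hg i
  have e3 := hf (i - 1)
  have e4 := hg (i - 1)
  have e5 := hf (n - 3)
  have e6 := hg (n - 3)
  clear hf hg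
  grind (splits := 40)

theorem exists_heads (n : ℕ) (hn : 4 ≤ n) (f g : ℕ → ℤ) (hf : RootFn n f) (hg : RootFn n g) :
    ∃ p q r, Heads n f g p q r := by
  rcases hf with ⟨a, b, h1, h2, hf⟩ | ⟨a, h1, hf⟩ | ⟨a, h1, hf⟩ | ⟨a, b, h1, h2, hf⟩ <;>
  rcases hg with ⟨c, d, k1, k2, hg⟩ | ⟨c, k1, hg⟩ | ⟨c, k1, hg⟩ | ⟨c, d, k1, k2, hg⟩
  · exact heads_11 n hn f g a b h1 h2 hf c d k1 k2 hg
  · exact heads_12 n hn f g a b h1 h2 hf c k1 hg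
  · exact heads_13 n hn f g a b h1 h2 hf c k1 hg
  · exact heads_14 n hn f g a b h1 h2 hf c d k1 k2 hg
  · obtain ⟨p, q, r, h⟩ := heads_12 n hn g f c d k1 k2 hg a h1 hf
    exact ⟨p, q, r, h.symm⟩
  · exact heads_22 n hn f g a h1 hf c k1 hg
  · exact heads_23 n hn f g a h1 hf c k1 hg
  · exact heads_24 n hn f g a h1 hf c d k1 k2 hg
  · obtain ⟨p, q, r, h⟩ := heads_13 n hn g f c d k1 k2 hg a h1 hf
    exact ⟨p, q, r, h.symm⟩
  · obtain ⟨p, q, r, h⟩ := heads_23 n hn g f c k1 hg a h1 hf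
    exact ⟨p, q, r, h.symm⟩
  · exact heads_33 n hn f g a h1 hf c k1 hg
  · exact heads_34 n hn f g a h1 hf c d k1 k2 hg
  · obtain ⟨p, q, r, h⟩ := heads_14 n hn g f c d k1 k2 hg a b h1 h2 hf
    exact ⟨p, q, r, h.symm⟩
  · obtain ⟨p, q, r, h⟩ := heads_24 n hn g f c k1 hg a b h1 h2 hf
    exact ⟨p, q, r, h.symm⟩
  · obtain ⟨p, q, r, h⟩ := heads_34 n hn g f c k1 hg a b h1 h2 hf
    exact ⟨p, q, r, h.symm⟩
  · exact heads_44 n hn f g a b h1 h2 hf c d k1 k2 hg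

theorem reach_head (n : ℕ) (hn : 4 ≤ n) (S : Set (Fin n)) (p q r : ℕ)
    (h : ∀ i ∈ S, (i.val = p ∨ i.val = q ∨ i.val = r) ∨
      ∃ j ∈ S, j.val < i.val ∧ (dynkinGraphD n).Adj i j) (m : ℕ) :
    ∀ i : S, i.val.val = m → ∃ j : S, (j.val.val = p ∨ j.val.val = q ∨ j.val.val = r) ∧
      ((dynkinGraphD n).induce S).Reachable i j := by
  induction m using Nat.strong_induction_on with
  | _ m ih =>
    intro i hi
    rcases h i.val i.2 with h1 | ⟨j, hj, hlt, hadj⟩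
    · exact ⟨i, h1, SimpleGraph.Reachable.refl _⟩
    · obtain ⟨k, hk, hr⟩ := ih j.val (by omega) ⟨j, hj⟩ rfl
      refine ⟨k, hk, SimpleGraph.Reachable.trans ?_ hr⟩
      apply SimpleGraph.Adj.reachable
      simpa using hadj

theorem card_le_three (n : ℕ) (hn : 4 ≤ n) (S : Set (Fin n)) (p q r : ℕ)
    (h : ∀ i ∈ S, (i.val = p ∨ i.val = q ∨ i.val = r) ∨
      ∃ j ∈ S, j.val < i.val ∧ (dynkinGraphD n).Adj i j) :
    Nat.card ((dynkinGraphD n).induce S).ConnectedComponent ≤ 3 := by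
  have key : ∀ C : ((dynkinGraphD n).induce S).ConnectedComponent,
      ∃ j : S, (j.val.val = p ∨ j.val.val = q ∨ j.val.val = r) ∧
        ((dynkinGraphD n).induce S).connectedComponentMk j = C := by
    intro C
    induction C using SimpleGraph.ConnectedComponent.ind with
    | _ v =>
      obtain ⟨j, hj, hr⟩ := reach_head n hn S p q r h _ v rfl
      exact ⟨j, hj, SimpleGraph.ConnectedComponent.sound hr.symm⟩
  choose F hF1 hF2 using key
  let G : ((dynkinGraphD n).induce S).ConnectedComponent → ({p, q, r} : Finset ℕ) :=
    fun C => ⟨(F C).val.val, by simpa using hF1 C⟩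
  have hG : Function.Injective G := by
    intro C D hCD
    have h1 : (F C).val.val = (F D).val.val := congrArg Subtype.val hCD
    have h2 : F C = F D := Subtype.ext (Fin.ext h1)
    rw [← hF2 C, ← hF2 D, h2]
  have h3 := Nat.card_le_card_of_injective G hG
  have h4 : Nat.card ({p, q, r} : Finset ℕ) ≤ 3 := by
    rw [Nat.card_eq_fintype_card, Fintype.card_coe]
    exact Finset.card_le_three
  exact h3.trans h4

/-- The support of the difference of two positive roots of type `Dₙ` has at most three
connected components in the Dynkin diagram of type `Dₙ`. -/
theorem support_diff_posRoots_typeD (n : ℕ) (hn : 4 ≤ n) (α β : Fin n → ℤ)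
    (hα : IsPosRootD n α) (hβ : IsPosRootD n β) :
    Nat.card
      ((dynkinGraphD n).induce
        {i : Fin n | α i - β i ≠ 0}).ConnectedComponent ≤ 3 := by
  obtain ⟨f, hf, hfv⟩ := exists_rootFn n α hα
  obtain ⟨g, hg, hgv⟩ := exists_rootFn n β hβ
  obtain ⟨p, q, r, h⟩ := exists_heads n hn f g hf hg
  apply card_le_three n hn _ p q r
  intro i hi
  have hne : f i.val ≠ g i.val := by
    have h0 : α i - β i ≠ 0 := hi
    rw [hfv, hgv] at h0
    exact sub_ne_zero.mp h0
  rcases h i.val i.2 hne with h1 | ⟨h1, h2⟩ | ⟨h1, h2, h3⟩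
  · exact Or.inl h1
  · refine Or.inr ⟨⟨n - 3, by omega⟩, ?_, ?_, ?_⟩
    · change α _ - β _ ≠ 0
      rw [hfv, hgv]
      exact sub_ne_zero.mpr h2
    · change n - 3 < i.val
      omega
    · rw [dynkinGraphD, SimpleGraph.fromRel_adj]
      refine ⟨fun e => ?_, Or.inr (Or.inr ⟨rfl, h1⟩)⟩
      have e' : i.val = n - 3 := congrArg Fin.val e
      omega
  · refine Or.inr ⟨⟨i.val - 1, by omega⟩, ?_, ?_, ?_⟩
    · change α _ - β _ ≠ 0
      rw [hfv, hgv]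
      exact sub_ne_zero.mpr h3
    · change i.val - 1 < i.val
      omega
    · rw [dynkinGraphD, SimpleGraph.fromRel_adj]
      refine ⟨fun e => ?_, Or.inr (Or.inl ⟨Nat.sub_add_cancel h1, h2⟩)⟩
      have e' : i.val = i.val - 1 := congrArg Fin.val e
      omega
end

section
/- Let n ≥ 7, let A be the Cartan matrix of type D_n, and let σ be any permutation of {1,…,n}. Define u = e_{n−1} + e_n if σ(n−2) lies strictly between σ(n−1) and σ(n), and u = e_{n−1} − e_n otherwise (where e_i is the i-th standard basis vector of ℤⁿ). If α and β are distinct positive roots of type D_n (written in simple-root coordinates) satisfying B_σ·α = B_σ·β, then β − α = u or β − α = −u. In particular, for any vector w ∈ ℤⁿ there are at most two positive roots α of type D_n with B_σ·α = w. -/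
open Matrix

/-- The Cartan matrix of type `Dₙ` (nodes indexed `0, …, n-1`; the Dynkin diagram has
edges `{i, i+1}` for `i + 1 ≤ n - 2` and the edge `{n-3, n-1}`). -/
def cartanD (n : ℕ) : Matrix (Fin n) (Fin n) ℤ :=
  fun i j => if i = j then 2
    else if (i.val + 1 = j.val ∧ j.val ≤ n - 2) ∨ (j.val + 1 = i.val ∧ i.val ≤ n - 2) ∨
      (i.val = n - 3 ∧ j.val = n - 1) ∨ (i.val = n - 1 ∧ j.val = n - 3) then -1 else 0

/-- The acyclic exchange matrix `B_σ` attached to a Cartan matrix `A` and a permutation `σ`: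
`b i i = 0`, `b i j = -a i j` if `σ i < σ j`, and `b i j = a i j` if `σ i > σ j`. -/
def Bmat {n : ℕ} (A : Matrix (Fin n) (Fin n) ℤ) (σ : Equiv.Perm (Fin n)) :
    Matrix (Fin n) (Fin n) ℤ :=
  fun i j => if i = j then 0 else if σ i < σ j then -A i j else A i j

/-- Shape of the first six coordinates of a root. -/
def ShapeD (x : ℕ → ℤ) : Prop :=
  (0 ≤ x 0 ∧ x 0 ≤ 1 ∧ x 0 ≤ x 1 ∧ x 1 ≤ x 2 ∧ x 2 ≤ x 3 ∧ x 3 ≤ x 4 ∧ x 4 ≤ x 5 ∧ x 5 ≤ 2) ∨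
  ((∀ i, 0 ≤ x i ∧ x i ≤ 1) ∧ ∀ i j k, i < j → j < k → k ≤ 5 → x i + x k - x j ≤ 1)

/-- Extension by zero. -/
def extD {n : ℕ} (v : Fin n → ℤ) (i : ℕ) : ℤ := if h : i < n then v ⟨i, h⟩ else 0

lemma shapeD_of_root {n : ℕ} (hn : 8 ≤ n) {v : Fin n → ℤ} (hv : IsPosRootD n v) :
    ShapeD (extD v) := by
  rcases hv with ⟨a, b, hab, hb, rfl⟩ | ⟨a, ha, rfl⟩ | ⟨a, ha, rfl⟩ | ⟨a, b, hab, hb, rfl⟩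
  · right
    constructor
    · intro i
      simp only [extD]
      split_ifs <;> omega
    · intro i j k hij hjk hk
      simp only [extD]
      split_ifs <;> omega
  · right
    constructor
    · intro i
      simp only [extD]
      split_ifs <;> omega
    · intro i j k hij hjk hk
      simp only [extD]
      split_ifs <;> omega
  · right
    constructor
    · intro i
      simp only [extD]
      split_ifs <;> omega
    · intro i j k hij hjk hk
      simp only [extD]
      split_ifs <;> omega
  · left
    have mono : ∀ i, i < 5 → extD (n := n) (fun i => if n - 2 ≤ i.val then 1
      else if b ≤ i.val then 2 else if a ≤ i.val then 1 else 0) i ≤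
       extD (n := n) (fun i => if n - 2 ≤ i.val then 1
      else if b ≤ i.val then 2 else if a ≤ i.val then 1 else 0) (i+1) := by
      intro i hi
      simp only [extD]
      split_ifs <;> omega
    refine ⟨?_, ?_, mono 0 (by omega), mono 1 (by omega), mono 2 (by omega), mono 3 (by omega),
      mono 4 (by omega), ?_⟩
    all_goals simp only [extD]; split_ifs <;> omega

lemma shapeD_contra {x y : ℕ → ℤ} (hx : ShapeD x) (hy : ShapeD y)
    (h1 : x 1 = y 1) (h3 : x 3 = y 3) (h5 : x 5 = y 5)
    (h0 : x 0 ≠ y 0) (h2 : x 2 ≠ y 2) (h4 : x 4 ≠ y 4) : False := by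
  rcases hx with hx | ⟨hx, hx'⟩ <;> rcases hy with hy | ⟨hy, hy'⟩
  · omega
  · have := hy 0; have := hy 1; have := hy 2; have := hy 3; have := hy 4; have := hy 5
    have := hy' 0 1 2; have := hy' 1 2 3; have := hy' 0 2 3; have := hy' 2 3 4
    have := hy' 0 1 4; have := hy' 0 2 4; have := hy' 0 3 4; have := hy' 1 2 4
    have := hy' 3 4 5; have := hy' 1 4 5; have := hy' 0 1 3; have := hy' 1 2 5
    omega
  · have := hx 0; have := hx 1; have := hx 2; have := hx 3; have := hx 4; have := hx 5
    have := hx' 0 1 2; have := hx' 1 2 3; have := hx' 0 2 3; have := hx' 2 3 4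
    have := hx' 0 1 4; have := hx' 0 2 4; have := hx' 0 3 4; have := hx' 1 2 4
    have := hx' 3 4 5; have := hx' 1 4 5; have := hx' 0 1 3; have := hx' 1 2 5
    omega
  · have := hy 0; have := hy 1; have := hy 2; have := hy 3; have := hy 4; have := hy 5
    have := hy' 0 1 2; have := hy' 1 2 3; have := hy' 0 2 3; have := hy' 2 3 4
    have := hy' 0 1 4; have := hy' 0 2 4; have := hy' 0 3 4; have := hy' 1 2 4
    have := hy' 3 4 5; have := hy' 1 4 5; have := hy' 0 1 3; have := hy' 1 2 5
    have := hx 0; have := hx 1; have := hx 2; have := hx 3; have := hx 4; have := hx 5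
    have := hx' 0 1 2; have := hx' 1 2 3; have := hx' 0 2 3; have := hx' 2 3 4
    have := hx' 0 1 4; have := hx' 0 2 4; have := hx' 0 3 4; have := hx' 1 2 4
    have := hx' 3 4 5; have := hx' 1 4 5; have := hx' 0 1 3; have := hx' 1 2 5
    omega

lemma root_bound {n : ℕ} (hn : 7 ≤ n) (p1 : n - 1 < n) (p2 : n - 2 < n) (p3 : n - 3 < n) {v : Fin n → ℤ} (hv : IsPosRootD n v) :
    0 ≤ v ⟨n - 2, p2⟩ ∧ v ⟨n - 2, p2⟩ ≤ 1 := by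
  rcases hv with ⟨a, b, hab, hb, rfl⟩ | ⟨a, ha, rfl⟩ | ⟨a, ha, rfl⟩ | ⟨a, b, hab, hb, rfl⟩ <;>
  · dsimp only
    split_ifs <;> omega

/-- Adjacency in the Dynkin diagram. -/
def AdjD (n i j : ℕ) : Prop := (i + 1 = j ∧ j ≤ n - 2) ∨ (j + 1 = i ∧ i ≤ n - 2) ∨
      (i = n - 3 ∧ j = n - 1) ∨ (i = n - 1 ∧ j = n - 3)

lemma Bmat_adj {n : ℕ} (hn : 7 ≤ n) (σ : Equiv.Perm (Fin n)) (i j : Fin n)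
    (h : AdjD n i.val j.val) :
    Bmat (cartanD n) σ i j = if σ i < σ j then 1 else -1 := by
  have hne : i ≠ j := by
    rintro rfl
    unfold AdjD at h
    omega
  have h' := h
  unfold AdjD at h'
  simp only [Bmat, cartanD, if_neg hne, if_pos h', neg_neg]

lemma Bmat_nonadj {n : ℕ} (σ : Equiv.Perm (Fin n)) (i j : Fin n)
    (h : ¬ AdjD n i.val j.val) :
    Bmat (cartanD n) σ i j = 0 := by
  unfold AdjD at h
  by_cases hne : i = j
  · simp [Bmat, hne]
  · simp only [Bmat, cartanD, if_neg hne, if_neg h, neg_zero, ite_self]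

lemma Bmat_adj_pm {n : ℕ} (hn : 7 ≤ n) (σ : Equiv.Perm (Fin n)) (i j : Fin n)
    (h : AdjD n i.val j.val) :
    Bmat (cartanD n) σ i j = 1 ∨ Bmat (cartanD n) σ i j = -1 := by
  rw [Bmat_adj hn σ i j h]
  split_ifs <;> simp

lemma row_one {n : ℕ} (hn : 7 ≤ n) (σ : Equiv.Perm (Fin n)) (d : Fin n → ℤ)
    (hd : (Bmat (cartanD n) σ).mulVec d = 0) (i p : Fin n) (hp : AdjD n i.val p.val)
    (ho : ∀ j : Fin n, j.val ≠ p.val → ¬ AdjD n i.val j.val) : d p = 0 := by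
  have h := congrFun hd i
  simp only [mulVec, dotProduct, Pi.zero_apply] at h
  rw [Fintype.sum_eq_single p] at h
  · rcases Bmat_adj_pm hn σ i p hp with h' | h' <;> rw [h'] at h <;> omega
  · intro j hj
    rw [Bmat_nonadj σ i j (ho j (fun h => hj (Fin.ext h))), zero_mul]

lemma row_two {n : ℕ} (hn : 7 ≤ n) (σ : Equiv.Perm (Fin n)) (d : Fin n → ℤ)
    (hd : (Bmat (cartanD n) σ).mulVec d = 0) (i p q : Fin n) (hp : AdjD n i.val p.val)
    (hq : AdjD n i.val q.val) (hpq : p.val ≠ q.val)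
    (ho : ∀ j : Fin n, j.val ≠ p.val → j.val ≠ q.val → ¬ AdjD n i.val j.val ∨ d j = 0) :
    Bmat (cartanD n) σ i p * d p + Bmat (cartanD n) σ i q * d q = 0 := by
  have h := congrFun hd i
  simp only [mulVec, dotProduct, Pi.zero_apply] at h
  rwa [Fintype.sum_eq_add p q (fun h => hpq (congrArg _ h))] at h
  rintro j ⟨hj, hj'⟩
  rcases ho j (fun h => hj (Fin.ext h)) (fun h => hj' (Fin.ext h)) with h0 | h0
  · rw [Bmat_nonadj σ i j h0, zero_mul]
  · rw [h0, mul_zero]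

lemma step_abs {n : ℕ} (hn : 7 ≤ n) (σ : Equiv.Perm (Fin n)) (d : Fin n → ℤ)
    (hd : (Bmat (cartanD n) σ).mulVec d = 0) (i : ℕ) (hi : i + 2 ≤ n - 3) :
    extD d i = 0 ↔ extD d (i + 2) = 0 := by
  have h := row_two hn σ d hd ⟨i + 1, by omega⟩ ⟨i, by omega⟩ ⟨i + 2, by omega⟩
    (by unfold AdjD; (try dsimp only); omega) (by unfold AdjD; (try dsimp only); omega) (by simp)
    (by intro j h1 h2; left; unfold AdjD; (try dsimp only); dsimp only at h1 h2; omega)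
  rw [extD, extD, dif_pos (by omega), dif_pos (by omega)]
  rcases Bmat_adj_pm hn σ ⟨i + 1, by omega⟩ ⟨i, by omega⟩ (by unfold AdjD; (try dsimp only); omega) with h1 | h1 <;>
  rcases Bmat_adj_pm hn σ ⟨i + 1, by omega⟩ ⟨i + 2, by omega⟩ (by unfold AdjD; (try dsimp only); omega) with h2 | h2 <;>
  rw [h1, h2] at h <;> omega

lemma chain {n : ℕ} (hn : 7 ≤ n) (σ : Equiv.Perm (Fin n)) (d : Fin n → ℤ)
    (hd : (Bmat (cartanD n) σ).mulVec d = 0) (i k : ℕ) (hi : i + 2 * k ≤ n - 3) :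
    extD d i = 0 ↔ extD d (i + 2 * k) = 0 := by
  induction k with
  | zero => simp
  | succ k ih =>
    rw [ih (by omega), step_abs hn σ d hd (i + 2 * k) (by omega)]
    rfl

lemma extD_sub {n : ℕ} (x y : Fin n → ℤ) (i : ℕ) : extD (y - x) i = extD y i - extD x i := by
  unfold extD
  split_ifs <;> simp

lemma low_zero {n : ℕ} (hn : 7 ≤ n) (σ : Equiv.Perm (Fin n)) (α β : Fin n → ℤ)
    (hα : IsPosRootD n α) (hβ : IsPosRootD n β)
    (hd : (Bmat (cartanD n) σ).mulVec (β - α) = 0) (i : ℕ) (hi : i ≤ n - 3) :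
    extD (β - α) i = 0 := by
  have h1 : extD (β - α) 1 = 0 := by
    rw [extD, dif_pos (by omega)]
    refine row_one hn σ _ hd ⟨0, by omega⟩ ⟨1, by omega⟩ ?_ ?_
    · unfold AdjD; (try dsimp only); omega
    · intro j hj; unfold AdjD; (try dsimp only); dsimp only at hj; omega
  have hl : extD (β - α) (n - 3) = 0 := by
    rw [extD, dif_pos (by omega)]
    refine row_one hn σ _ hd ⟨n - 1, by omega⟩ ⟨n - 3, by omega⟩ ?_ ?_
    · unfold AdjD; (try dsimp only); omega
    · intro j hj; unfold AdjD; (try dsimp only); dsimp only at hj; omega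
  have h0 : extD (β - α) 0 = 0 := by
    rcases Nat.even_or_odd' n with ⟨m, hm | hm⟩
    · by_contra h0
      have c := chain hn σ _ hd
      have c2 := (c 0 1 (by omega)).not.mp h0
      have c4 := (c 0 2 (by omega)).not.mp h0
      have c3 := (c 1 1 (by omega)).mp h1
      have c5 := (c 1 2 (by omega)).mp h1
      norm_num at c2 c3 c4 c5
      rw [extD_sub] at *
      exact shapeD_contra (shapeD_of_root (by omega) hβ) (shapeD_of_root (by omega) hα)
        (by omega) (by omega) (by omega) (by omega) (by omega) (by omega)
    · rw [chain hn σ _ hd 0 (m - 1) (by omega)]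
      convert hl using 2
      omega
  rcases Nat.even_or_odd' i with ⟨m, rfl | rfl⟩
  · have := (chain hn σ _ hd 0 m (by omega)).mp h0
    rwa [zero_add] at this
  · have := (chain hn σ _ hd 1 m (by omega)).mp h1
    rwa [add_comm] at this

lemma diff_eq_u {n : ℕ} (hn : 7 ≤ n) (p1 : n - 1 < n) (p2 : n - 2 < n) (p3 : n - 3 < n) (σ : Equiv.Perm (Fin n)) (α β : Fin n → ℤ)
    (hα : IsPosRootD n α) (hβ : IsPosRootD n β) (hne : α ≠ β)
    (h : (Bmat (cartanD n) σ).mulVec α = (Bmat (cartanD n) σ).mulVec β) :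
      β - α =
        (if min (σ ⟨n - 2, p2⟩) (σ ⟨n - 1, p1⟩) < σ ⟨n - 3, p3⟩ ∧
            σ ⟨n - 3, p3⟩ < max (σ ⟨n - 2, p2⟩) (σ ⟨n - 1, p1⟩) then
          Pi.single (⟨n - 2, p2⟩ : Fin n) (1 : ℤ) +
            Pi.single (⟨n - 1, p1⟩ : Fin n) (1 : ℤ)
        else
          Pi.single (⟨n - 2, p2⟩ : Fin n) (1 : ℤ) -
            Pi.single (⟨n - 1, p1⟩ : Fin n) (1 : ℤ)) ∨
      β - α =
        -(if min (σ ⟨n - 2, p2⟩) (σ ⟨n - 1, p1⟩) < σ ⟨n - 3, p3⟩ ∧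
            σ ⟨n - 3, p3⟩ < max (σ ⟨n - 2, p2⟩) (σ ⟨n - 1, p1⟩) then
          Pi.single (⟨n - 2, p2⟩ : Fin n) (1 : ℤ) +
            Pi.single (⟨n - 1, p1⟩ : Fin n) (1 : ℤ)
        else
          Pi.single (⟨n - 2, p2⟩ : Fin n) (1 : ℤ) -
            Pi.single (⟨n - 1, p1⟩ : Fin n) (1 : ℤ)) := by
  have hd : (Bmat (cartanD n) σ).mulVec (β - α) = 0 := by
    rw [mulVec_sub, h, sub_self]
  have low : ∀ i : Fin n, i.val ≤ n - 3 → (β - α) i = 0 := by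
    intro i hi
    have := low_zero hn σ α β hα hβ hd i.val hi
    rwa [extD, dif_pos i.isLt] at this
  have b1 := root_bound hn (by omega) (by omega) (by omega) hα
  have b2 := root_bound hn (by omega) (by omega) (by omega) hβ
  have a2 : AdjD n (n - 3) (n - 2) := by unfold AdjD; (try dsimp only); omega
  have a1 : AdjD n (n - 3) (n - 1) := by unfold AdjD; (try dsimp only); omega
  have row := row_two hn σ (β - α) hd ⟨n - 3, by omega⟩ ⟨n - 2, by omega⟩ ⟨n - 1, by omega⟩
    a2 a1 (by simp only; omega)
    (by
      intro j h1 h2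
      right
      dsimp only at h1 h2
      exact low j (by omega))
  rw [Bmat_adj hn σ _ _ a2, Bmat_adj hn σ _ _ a1] at row
  have hx : (β - α) ⟨n - 2, by omega⟩ = β ⟨n - 2, by omega⟩ - α ⟨n - 2, by omega⟩ := rfl
  have nz : ¬ ((β - α) ⟨n - 2, by omega⟩ = 0 ∧ (β - α) ⟨n - 1, by omega⟩ = 0) := by
    rintro ⟨z2, z1⟩
    apply hne
    symm
    rw [← sub_eq_zero]
    funext i
    by_cases hi : i.val ≤ n - 3
    · exact low i hi
    · by_cases hi2 : i.val = n - 2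
      · rw [show i = ⟨n - 2, by omega⟩ from Fin.ext hi2]; exact z2
      · rw [show i = ⟨n - 1, by omega⟩ from Fin.ext (by simp only; omega)]; exact z1
  have key : ∀ v : Fin n → ℤ, (∀ i : Fin n, i.val ≤ n - 3 → v i = 0) →
      (β - α) ⟨n - 2, by omega⟩ = v ⟨n - 2, by omega⟩ →
      (β - α) ⟨n - 1, by omega⟩ = v ⟨n - 1, by omega⟩ → β - α = v := by
    intro v hv e2 e1
    funext i
    by_cases hi : i.val ≤ n - 3
    · rw [low i hi, hv i hi]
    · by_cases hi2 : i.val = n - 2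
      · rw [show i = ⟨n - 2, by omega⟩ from Fin.ext hi2]; exact e2
      · rw [show i = ⟨n - 1, by omega⟩ from Fin.ext (by simp only; omega)]; exact e1
  generalize β - α = d at *
  have s32 : σ ⟨n - 3, by omega⟩ ≠ σ ⟨n - 2, by omega⟩ := by
    intro h; have := σ.injective h; simp only [Fin.mk.injEq] at this; omega
  have s31 : σ ⟨n - 3, by omega⟩ ≠ σ ⟨n - 1, by omega⟩ := by
    intro h; have := σ.injective h; simp only [Fin.mk.injEq] at this; omega
  have n21 : n - 2 ≠ n - 1 := by omega
  have n12 : n - 1 ≠ n - 2 := by omega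
  have l2 : ∀ i : Fin n, i.val ≤ n - 3 → i ≠ ⟨n - 2, by omega⟩ := by
    rintro i hi rfl; dsimp only at hi; omega
  have l1 : ∀ i : Fin n, i.val ≤ n - 3 → i ≠ ⟨n - 1, by omega⟩ := by
    rintro i hi rfl; dsimp only at hi; omega
  have hd2 : d ⟨n - 2, by omega⟩ = 1 ∨ d ⟨n - 2, by omega⟩ = -1 := by
    split_ifs at row <;> omega
  by_cases hb : min (σ ⟨n - 2, by omega⟩) (σ ⟨n - 1, by omega⟩) < σ ⟨n - 3, by omega⟩ ∧
            σ ⟨n - 3, by omega⟩ < max (σ ⟨n - 2, by omega⟩) (σ ⟨n - 1, by omega⟩)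
  · rw [if_pos hb]
    have e : d ⟨n - 1, by omega⟩ = d ⟨n - 2, by omega⟩ := by
      rw [min_lt_iff, lt_max_iff] at hb
      split_ifs at row <;> omega
    rcases hd2 with h2 | h2
    · left
      apply key
      · intro i hi; simp [l1 i hi, l2 i hi]
      · simp [h2, n21, n12]
      · simp [e, h2, n21, n12]
    · right
      apply key
      · intro i hi; simp [l1 i hi, l2 i hi]
      · simp [h2, n21, n12]
      · simp [e, h2, n21, n12]
  · rw [if_neg hb]
    have e : d ⟨n - 1, by omega⟩ = - d ⟨n - 2, by omega⟩ := by
      rw [min_lt_iff, lt_max_iff] at hb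
      split_ifs at row <;> omega
    rcases hd2 with h2 | h2
    · left
      apply key
      · intro i hi; simp [l1 i hi, l2 i hi]
      · simp [h2, n21, n12]
      · simp [e, h2, n21, n12]
    · right
      apply key
      · intro i hi; simp [l1 i hi, l2 i hi]
      · simp [h2, n21, n12]
      · simp [e, h2, n21, n12]

lemma diff_coord {n : ℕ} (hn : 7 ≤ n) (p1 : n - 1 < n) (p2 : n - 2 < n) (p3 : n - 3 < n) (σ : Equiv.Perm (Fin n)) (α β : Fin n → ℤ)
    (hα : IsPosRootD n α) (hβ : IsPosRootD n β) (hne : α ≠ β)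
    (h : (Bmat (cartanD n) σ).mulVec α = (Bmat (cartanD n) σ).mulVec β) :
    β ⟨n - 2, p2⟩ - α ⟨n - 2, p2⟩ = 1 ∨
    β ⟨n - 2, p2⟩ - α ⟨n - 2, p2⟩ = -1 := by
  have n21 : n - 2 ≠ n - 1 := by omega
  rcases diff_eq_u hn (by omega) (by omega) (by omega) σ α β hα hβ hne h with h | h
  · left
    have := congrFun h ⟨n - 2, by omega⟩
    rw [Pi.sub_apply] at this
    rw [this]
    split_ifs <;> simp [n21]
  · right
    have := congrFun h ⟨n - 2, by omega⟩
    rw [Pi.sub_apply] at this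
    rw [this]
    split_ifs <;> simp [n21]

theorem Bmat_posRoots_typeD (n : ℕ) (hn : 7 ≤ n) (σ : Equiv.Perm (Fin n)) :
    (∀ α β : Fin n → ℤ, IsPosRootD n α → IsPosRootD n β → α ≠ β →
      (Bmat (cartanD n) σ).mulVec α = (Bmat (cartanD n) σ).mulVec β →
      β - α =
        (if min (σ ⟨n - 2, by omega⟩) (σ ⟨n - 1, by omega⟩) < σ ⟨n - 3, by omega⟩ ∧
            σ ⟨n - 3, by omega⟩ < max (σ ⟨n - 2, by omega⟩) (σ ⟨n - 1, by omega⟩) then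
          Pi.single (⟨n - 2, by omega⟩ : Fin n) (1 : ℤ) +
            Pi.single (⟨n - 1, by omega⟩ : Fin n) (1 : ℤ)
        else
          Pi.single (⟨n - 2, by omega⟩ : Fin n) (1 : ℤ) -
            Pi.single (⟨n - 1, by omega⟩ : Fin n) (1 : ℤ)) ∨
      β - α =
        -(if min (σ ⟨n - 2, by omega⟩) (σ ⟨n - 1, by omega⟩) < σ ⟨n - 3, by omega⟩ ∧
            σ ⟨n - 3, by omega⟩ < max (σ ⟨n - 2, by omega⟩) (σ ⟨n - 1, by omega⟩) then
          Pi.single (⟨n - 2, by omega⟩ : Fin n) (1 : ℤ) +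
            Pi.single (⟨n - 1, by omega⟩ : Fin n) (1 : ℤ)
        else
          Pi.single (⟨n - 2, by omega⟩ : Fin n) (1 : ℤ) -
            Pi.single (⟨n - 1, by omega⟩ : Fin n) (1 : ℤ))) ∧
    (∀ w : Fin n → ℤ, ∀ α₁ α₂ α₃ : Fin n → ℤ,
      IsPosRootD n α₁ → IsPosRootD n α₂ → IsPosRootD n α₃ →
      (Bmat (cartanD n) σ).mulVec α₁ = w → (Bmat (cartanD n) σ).mulVec α₂ = w →
      (Bmat (cartanD n) σ).mulVec α₃ = w →
      α₁ = α₂ ∨ α₁ = α₃ ∨ α₂ = α₃) := by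
  refine ⟨?_, ?_⟩
  · intro α β hα hβ hne h
    exact diff_eq_u hn (by omega) (by omega) (by omega) σ α β hα hβ hne h
  · intro w α₁ α₂ α₃ r1 r2 r3 h1 h2 h3
    by_contra hc
    push Not at hc
    obtain ⟨n12, n13, n23⟩ := hc
    have b1 := root_bound hn (by omega) (by omega) (by omega) r1
    have b2 := root_bound hn (by omega) (by omega) (by omega) r2
    have b3 := root_bound hn (by omega) (by omega) (by omega) r3
    have e12 := diff_coord hn (by omega) (by omega) (by omega) σ _ _ r1 r2 n12 (h1.trans h2.symm)
    have e13 := diff_coord hn (by omega) (by omega) (by omega) σ _ _ r1 r3 n13 (h1.trans h3.symm)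
    have e23 := diff_coord hn (by omega) (by omega) (by omega) σ _ _ r2 r3 n23 (h2.trans h3.symm)
    omega
end
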